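/- Let k be a number field and let λ and ω be non-zero elements of k such that λ is not a multiplicative power of ω (i.e., λ ≠ ω^n for every integer n). Let P be a finite set of non-zero prime ideals of O_k. Then there exist non-zero prime ideals 𝔭 and 𝔮 of O_k, lying outside P, such that λ and ω have non-negative valuation at both 𝔭 and 𝔮, and the pair (η_𝔭(λ), η_𝔮(λ)) is not a multiplicative power of the pair (η_𝔭(ω), η_𝔮(ω)) in the product of the residue fields; that is, for every integer n, (η_𝔭(λ), η_𝔮(λ)) ≠ (η_𝔭(ω)^n, η_𝔮(ω)^n). -/

import Mathlib

set_option synthInstance.maxHeartbeats 400000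
set_option maxHeartbeats 800000

open NumberField

/-- `ResidueImage 𝔭 x c` says that `x ∈ k` has non-negative `𝔭`-adic valuation
(i.e. `x = a/b` with `a, b ∈ 𝓞 k`, `b ∉ 𝔭`) and that `c` is the image of `x` under the
residue class field map `η_𝔭` into `𝓞 k ⧸ 𝔭`. -/
def ResidueImage {k : Type} [Field k] [NumberField k] (𝔭 : Ideal (𝓞 k)) (x : k)
    (c : (𝓞 k) ⧸ 𝔭) : Prop :=
  ∃ a b : 𝓞 k, b ∉ 𝔭 ∧ x * algebraMap (𝓞 k) k b = algebraMap (𝓞 k) k a ∧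
    Ideal.Quotient.mk 𝔭 a = c * Ideal.Quotient.mk 𝔭 b

open Filter Topology in
theorem not_injective_of_linear_growth {ι κ : Type*} (N : ι → ℕ) (N' : κ → ℕ)
    (hN : ∀ i, 0 < N i) (hfin : ∀ x : ℝ, {i | (N i : ℝ) ≤ x}.Finite)
    (hfin' : ∀ x : ℝ, {j | (N' j : ℝ) ≤ x}.Finite) {c C : ℝ} (hc : 0 < c)
    (hlim : Tendsto (fun x : ℝ ↦ ({i | (N i : ℝ) ≤ x}.ncard : ℝ) / x) atTop (𝓝 c))
    (hlim' : Tendsto (fun x : ℝ ↦ ({j | (N' j : ℝ) ≤ x}.ncard : ℝ) / x) atTop (𝓝 C))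
    (Φ : ι × ι → κ) (hΦ : ∀ i j, N' (Φ (i, j)) = N i * N j) : ¬ Φ.Injective := by
  classical
  intro hinj
  have key (F : Finset ι) : ∑ j ∈ F, c * (N j : ℝ)⁻¹ ≤ C := by
    have h1 : Tendsto (fun x : ℝ ↦ ∑ j ∈ F,
        (({i | (N i : ℝ) ≤ x / N j}.ncard : ℝ) / (x / N j)) * (N j : ℝ)⁻¹) atTop
        (𝓝 (∑ j ∈ F, c * (N j : ℝ)⁻¹)) := by
      refine tendsto_finsetSum _ fun j _ ↦ Tendsto.mul_const _ ?_
      exact hlim.comp (tendsto_id.atTop_div_const (by exact_mod_cast hN j))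
    refine le_of_tendsto_of_tendsto h1 hlim' ?_
    filter_upwards [eventually_gt_atTop 0] with x hx
    have h2 (j : ι) : (({i | (N i : ℝ) ≤ x / N j}.ncard : ℝ) / (x / N j)) * (N j : ℝ)⁻¹ =
        ((hfin (x / N j)).toFinset.card : ℝ) / x := by
      have : (N j : ℝ) ≠ 0 := by exact_mod_cast (hN j).ne'
      rw [Set.ncard_eq_toFinset_card _ (hfin (x / N j))]
      generalize (hfin (x / N j)).toFinset.card = n
      field_simp
    simp_rw [h2]
    rw [← Finset.sum_div, Set.ncard_eq_toFinset_card _ (hfin' _)]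
    gcongr
    rw [← Nat.cast_sum, ← Finset.card_sigma]
    norm_cast
    refine Finset.card_le_card_of_injOn (fun p ↦ Φ (p.2, p.1)) ?_ ?_
    · rintro ⟨j, i⟩ hp
      have : (0 : ℝ) < N j := by exact_mod_cast hN j
      simp only [Finset.coe_sigma, Set.Finite.coe_toFinset, Set.mem_sigma_iff, SetLike.mem_coe,
        Set.mem_ofPred_eq] at hp
      simp only [Set.Finite.coe_toFinset, Set.mem_ofPred_eq, hΦ, Nat.cast_mul]
      exact (le_div_iff₀ this).mp hp.2
    · rintro ⟨j, i⟩ - ⟨j', i'⟩ - h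
      have := hinj h
      simp only [Prod.mk.injEq] at this
      rw [this.1, this.2]
  have hsum : Summable fun j ↦ c * (N j : ℝ)⁻¹ :=
    summable_of_sum_le (fun j ↦ by positivity) key
  obtain ⟨F, hF⟩ := summable_iff_vanishing_norm.mp hsum (c * (c / 4)) (by positivity)
  have hlim2 : Tendsto (fun x : ℝ ↦ ({i | (N i : ℝ) ≤ 2 * x}.ncard : ℝ) / (2 * x)
      - ({i | (N i : ℝ) ≤ x}.ncard : ℝ) / x * (1 / 2)) atTop (𝓝 (c - c * (1 / 2))) :=
    (hlim.comp (tendsto_id.const_mul_atTop two_pos)).sub (hlim.mul_const _)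
  obtain ⟨x, hx0, hxF, hx⟩ := ((eventually_gt_atTop (0 : ℝ)).and
    (((Filter.eventually_all_finset F).mpr
      fun i _ ↦ eventually_ge_atTop (N i : ℝ)).and
    (hlim2.eventually (lt_mem_nhds (show c / 4 < c - c * (1 / 2) by linarith))))).exists
  set G := (hfin (2 * x)).toFinset \ (hfin x).toFinset with hG
  have hdisj : Disjoint G F := by
    rw [Finset.disjoint_left]
    intro i hi hiF
    simp only [hG, Finset.mem_sdiff, Set.Finite.mem_toFinset, Set.mem_ofPred_eq] at hi
    exact hi.2 (hxF i hiF)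
  have h3 := hF G hdisj
  have hsub : (hfin x).toFinset ⊆ (hfin (2 * x)).toFinset := by
    intro i
    simp only [Set.Finite.mem_toFinset, Set.mem_ofPred_eq]
    intro h
    linarith
  have h4 : c * (c / 4) < ∑ i ∈ G, c * (N i : ℝ)⁻¹ := by
    rw [← Finset.mul_sum]
    gcongr
    calc c / 4 < (G.card : ℝ) / (2 * x) := by
          rw [Set.ncard_eq_toFinset_card _ (hfin _), Set.ncard_eq_toFinset_card _ (hfin _)] at hx
          have : (G.card : ℝ) = (hfin (2 * x)).toFinset.card - (hfin x).toFinset.card := by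
            rw [hG, Finset.cast_card_sdiff hsub]
          rw [this]
          refine hx.trans_eq ?_
          ring
      _ = ∑ i ∈ G, (2 * x)⁻¹ := by simp [div_eq_mul_inv]
      _ ≤ _ := by
          refine Finset.sum_le_sum fun i hi ↦ ?_
          simp only [hG, Finset.mem_sdiff, Set.Finite.mem_toFinset, Set.mem_ofPred_eq] at hi
          have : (0 : ℝ) < N i := by exact_mod_cast hN i
          gcongr
          exact hi.1
  rw [Real.norm_eq_abs] at h3
  exact absurd (lt_of_le_of_lt (le_abs_self _) h3) (not_lt.mpr h4.le)

open Filter Topology Ideal in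
theorem exists_tendsto_card_ideals_coprime (K : Type*) [Field K] [NumberField K]
    (s : Finset (Ideal (𝓞 K))) (hs : ∀ p ∈ s, p.IsPrime ∧ p ≠ ⊥) :
    ∃ c : ℝ, 0 < c ∧ Tendsto (fun x : ℝ ↦
      ({I : Ideal (𝓞 K) | (I ≠ ⊥ ∧ ∀ p ∈ s, ¬ p ∣ I) ∧ (absNorm I : ℝ) ≤ x}.ncard : ℝ) / x)
      atTop (𝓝 c) := by
  classical
  have hfin (s : Finset (Ideal (𝓞 K))) (x : ℝ) :
      {I : Ideal (𝓞 K) | (I ≠ ⊥ ∧ ∀ p ∈ s, ¬ p ∣ I) ∧ (absNorm I : ℝ) ≤ x}.Finite := by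
    refine (Ideal.finite_setOfPred_absNorm_le (S := 𝓞 K) ⌊x⌋₊).subset fun I hI ↦ ?_
    exact Nat.le_floor hI.2
  induction s using Finset.induction_on with
  | empty =>
    refine ⟨dedekindZeta_residue K, dedekindZeta_residue_pos K, ?_⟩
    refine (NumberField.Ideal.tendsto_norm_le_div_atTop₀ K).congr fun x ↦ ?_
    congr 2
    rw [← Nat.card_coe_set_eq]
    refine Nat.card_congr ⟨fun I ↦ ⟨I.1.1, by simpa using nonZeroDivisors.coe_ne_zero I.1, I.2⟩,
      fun I ↦ ⟨⟨I.1, mem_nonZeroDivisors_of_ne_zero I.2.1.1⟩, I.2.2⟩, fun _ ↦ rfl, fun _ ↦ rfl⟩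
  | insert p s hps ih =>
    obtain ⟨c, hc, hlim⟩ := ih fun q hq ↦ hs q (Finset.mem_insert_of_mem hq)
    obtain ⟨hp, hp0⟩ := hs p (Finset.mem_insert_self _ _)
    have hNp : 1 < absNorm p := by
      have h0 : absNorm p ≠ 0 := absNorm_eq_zero_iff.not.mpr hp0
      have h1 : absNorm p ≠ 1 := absNorm_eq_one_iff.not.mpr hp.ne_top
      omega
    have hNp' : (1 : ℝ) < absNorm p := by exact_mod_cast hNp
    refine ⟨c - c * (absNorm p : ℝ)⁻¹, ?_, ?_⟩
    · have := inv_lt_one_of_one_lt₀ hNp'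
      nlinarith
    · refine (hlim.sub ((hlim.comp (tendsto_id.atTop_div_const
        (show (0 : ℝ) < absNorm p by linarith))).mul_const (absNorm p : ℝ)⁻¹)).congr' ?_
      filter_upwards [eventually_gt_atTop 0] with x hx
      have hunion : {I : Ideal (𝓞 K) | (I ≠ ⊥ ∧ ∀ q ∈ s, ¬ q ∣ I) ∧ (absNorm I : ℝ) ≤ x} =
          {I : Ideal (𝓞 K) | (I ≠ ⊥ ∧ ∀ q ∈ insert p s, ¬ q ∣ I) ∧ (absNorm I : ℝ) ≤ x} ∪
          (p * ·) '' {I : Ideal (𝓞 K) | (I ≠ ⊥ ∧ ∀ q ∈ s, ¬ q ∣ I) ∧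
            (absNorm I : ℝ) ≤ x / absNorm p} := by
        ext I
        simp only [Set.mem_ofPred_eq, Set.mem_union, Set.mem_image, Finset.forall_mem_insert]
        constructor
        · rintro ⟨⟨h0, h1⟩, h2⟩
          by_cases hd : p ∣ I
          · obtain ⟨J, rfl⟩ := hd
            refine Or.inr ⟨J, ⟨⟨right_ne_zero_of_mul h0, fun q hq hqJ ↦
              h1 q hq (hqJ.mul_left p)⟩, ?_⟩, rfl⟩
            rw [le_div_iff₀ (by linarith), mul_comm]
            simpa using h2
          · exact Or.inl ⟨⟨h0, hd, h1⟩, h2⟩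
        · rintro (⟨⟨h0, -, h1⟩, h2⟩ | ⟨J, ⟨⟨h0, h1⟩, h2⟩, rfl⟩)
          · exact ⟨⟨h0, h1⟩, h2⟩
          · refine ⟨⟨mul_ne_zero hp0 h0, fun q hq hqJ ↦ ?_⟩, ?_⟩
            · obtain ⟨hqp, hq0⟩ := hs q (Finset.mem_insert_of_mem hq)
              rcases (Ideal.prime_of_isPrime hq0 hqp).dvd_or_dvd hqJ with h | h
              · have := (hqp.isMaximal hq0).eq_of_le hp.ne_top
                have hh := (hp.isMaximal hp0).eq_of_le hqp.ne_top (Ideal.le_of_dvd h)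
                exact hps (hh ▸ hq)
              · exact h1 q hq h
            · rw [le_div_iff₀ (by linarith), mul_comm] at h2
              simpa using h2
      rw [hunion, Set.ncard_union_eq ?_ (hfin _ _) ((hfin _ _).image _),
        Set.ncard_image_of_injective _ (mul_right_injective₀ hp0)]
      · simp only [Function.comp_apply, id_eq, Nat.cast_add]
        have : (absNorm p : ℝ) ≠ 0 := by linarith
        generalize Set.ncard {I : Ideal (𝓞 K) | (I ≠ ⊥ ∧ ∀ q ∈ s, ¬ q ∣ I) ∧
          (absNorm I : ℝ) ≤ x / absNorm p} = n
        field_simp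
        ring
      · rw [Set.disjoint_left]
        rintro I hI ⟨J, -, rfl⟩
        exact hI.1.2 p (Finset.mem_insert_self _ _) (dvd_mul_right _ _)

theorem image_val_setOf_le {α : Type*} (p : α → Prop) (f : α → ℝ) (x : ℝ) :
    Subtype.val '' {a : {a // p a} | f a.1 ≤ x} = {a | p a ∧ f a ≤ x} := by
  ext
  simp [and_comm]

open UniqueFactorizationMonoid Filter Topology Ideal in
theorem not_forall_exists_pair_primes_over (K L : Type*) [Field K] [NumberField K]
    [Field L] [NumberField L] [Algebra K L] (D : 𝓞 K) (hD : D ≠ 0)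
    (h : ∀ p : Ideal (𝓞 K), p.IsPrime → p ≠ ⊥ → D ∉ p → ∃ q₁ q₂ : Ideal (𝓞 L),
      q₁ ≠ q₂ ∧ (q₁.IsPrime ∧ q₁.under (𝓞 K) = p ∧ absNorm q₁ = absNorm p) ∧
      (q₂.IsPrime ∧ q₂.under (𝓞 K) = p ∧ absNorm q₂ = absNorm p)) : False := by
  classical
  choose! Q₁ Q₂ hne hQ₁ hQ₂ using h
  have hfinD : {p : Ideal (𝓞 K) | p ∣ span {D}}.Finite :=
    have := UniqueFactorizationMonoid.fintypeSubtypeDvd (span {D}) (by simpa using hD)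
    (Set.finite_range (Subtype.val : {p // p ∣ span {D}} → Ideal (𝓞 K))).subset
      fun p hp ↦ ⟨⟨p, hp⟩, rfl⟩
  set s : Finset (Ideal (𝓞 K)) := {p ∈ hfinD.toFinset | p.IsPrime} with hs
  have hsP : ∀ p ∈ s, p.IsPrime ∧ p ≠ ⊥ := by
    intro p hp
    simp only [hs, Finset.mem_filter, Set.Finite.mem_toFinset, Set.mem_ofPred_eq] at hp
    refine ⟨hp.2, fun h0 ↦ hD ?_⟩
    have := hp.1
    rw [h0, Ideal.dvd_span_singleton] at this
    simpa using this
  obtain ⟨c, hc, hlim⟩ := exists_tendsto_card_ideals_coprime K s hsP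
  obtain ⟨C, -, hlim'⟩ := exists_tendsto_card_ideals_coprime L ∅ (by simp)
  let ι := {I : Ideal (𝓞 K) // I ≠ ⊥ ∧ ∀ p ∈ s, ¬ p ∣ I}
  let κ := {I : Ideal (𝓞 L) // I ≠ ⊥}
  have hgood (I : ι) : ∀ p ∈ normalizedFactors I.1, p.IsPrime ∧ p ≠ ⊥ ∧ D ∉ p := by
    intro p hp
    have hpp := prime_of_normalized_factor p hp
    refine ⟨Ideal.isPrime_of_prime hpp, hpp.ne_zero, fun hDp ↦ I.2.2 p ?_
      (dvd_of_mem_normalizedFactors hp)⟩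
    simp only [hs, Finset.mem_filter, Set.Finite.mem_toFinset, Set.mem_ofPred_eq]
    exact ⟨Ideal.dvd_span_singleton.mpr hDp, Ideal.isPrime_of_prime hpp⟩
  have hne0 (q : Ideal (𝓞 L)) (p : Ideal (𝓞 K)) (hp : p ≠ ⊥) (hq : q.under (𝓞 K) = p) :
      q ≠ ⊥ := by
    rintro rfl
    refine hp (hq ▸ ?_)
    rw [Ideal.under_def]
    exact Ideal.comap_bot_of_injective _ (FaithfulSMul.algebraMap_injective _ _)
  have hpr₁ (I : ι) : ∀ q ∈ (normalizedFactors I.1).map Q₁, Prime q := by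
    intro q hq
    obtain ⟨p, hp, rfl⟩ := Multiset.mem_map.mp hq
    obtain ⟨h1, h2, h3⟩ := hgood I p hp
    exact Ideal.prime_of_isPrime (hne0 _ p h2 (hQ₁ p h1 h2 h3).2.1) (hQ₁ p h1 h2 h3).1
  have hpr₂ (I : ι) : ∀ q ∈ (normalizedFactors I.1).map Q₂, Prime q := by
    intro q hq
    obtain ⟨p, hp, rfl⟩ := Multiset.mem_map.mp hq
    obtain ⟨h1, h2, h3⟩ := hgood I p hp
    exact Ideal.prime_of_isPrime (hne0 _ p h2 (hQ₂ p h1 h2 h3).2.1) (hQ₂ p h1 h2 h3).1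
  have hnorm₁ (I : ι) : absNorm ((normalizedFactors I.1).map Q₁).prod = absNorm I.1 := by
    conv_rhs => rw [← Ideal.prod_normalizedFactors_eq_self I.2.1]
    rw [map_multiset_prod, map_multiset_prod, Multiset.map_map]
    congr 1
    refine Multiset.map_congr rfl fun p hp ↦ ?_
    obtain ⟨h1, h2, h3⟩ := hgood I p hp
    exact (hQ₁ p h1 h2 h3).2.2
  have hnorm₂ (I : ι) : absNorm ((normalizedFactors I.1).map Q₂).prod = absNorm I.1 := by
    conv_rhs => rw [← Ideal.prod_normalizedFactors_eq_self I.2.1]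
    rw [map_multiset_prod, map_multiset_prod, Multiset.map_map]
    congr 1
    refine Multiset.map_congr rfl fun p hp ↦ ?_
    obtain ⟨h1, h2, h3⟩ := hgood I p hp
    exact (hQ₂ p h1 h2 h3).2.2
  let Φ : ι × ι → κ := fun a ↦ ⟨((normalizedFactors a.1.1).map Q₁ +
    (normalizedFactors a.2.1).map Q₂).prod, by
      rw [Multiset.prod_add]
      refine mul_ne_zero ?_ ?_ <;> refine Multiset.prod_ne_zero fun h0 ↦ ?_
      · exact (hpr₁ _ _ h0).ne_zero rfl
      · exact (hpr₂ _ _ h0).ne_zero rfl⟩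
  refine not_injective_of_linear_growth (ι := ι) (κ := κ) (C := C) (fun I ↦ absNorm I.1)
    (fun I ↦ absNorm I.1) ?_ ?_ ?_ hc ?_ ?_ Φ ?_ ?_
  · exact fun I ↦ Nat.pos_of_ne_zero (absNorm_eq_zero_iff.not.mpr I.2.1)
  · intro x
    refine Set.Finite.of_finite_image ?_ Subtype.val_injective.injOn
    refine (Ideal.finite_setOfPred_absNorm_le (S := 𝓞 K) ⌊x⌋₊).subset ?_
    rintro _ ⟨I, hI, rfl⟩
    exact Nat.le_floor hI
  · intro x
    refine Set.Finite.of_finite_image ?_ Subtype.val_injective.injOn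
    refine (Ideal.finite_setOfPred_absNorm_le (S := 𝓞 L) ⌊x⌋₊).subset ?_
    rintro _ ⟨I, hI, rfl⟩
    exact Nat.le_floor hI
  · refine hlim.congr fun x ↦ ?_
    rw [← Set.ncard_image_of_injective _ (Subtype.val_injective (p := fun I : Ideal (𝓞 K) ↦
      I ≠ ⊥ ∧ ∀ p ∈ s, ¬ p ∣ I)), image_val_setOf_le _ (fun I ↦ (absNorm I : ℝ))]
  · refine hlim'.congr fun x ↦ ?_
    rw [← Set.ncard_image_of_injective _ (Subtype.val_injective (p := fun I : Ideal (𝓞 L) ↦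
      I ≠ ⊥)), image_val_setOf_le _ (fun I ↦ (absNorm I : ℝ))]
    simp
  · intro a b
    simp only [Φ, Multiset.prod_add, map_mul, hnorm₁, hnorm₂]
  · rintro ⟨a, b⟩ ⟨a', b'⟩ hab
    have hfac (a b : ι) : normalizedFactors (Φ (a, b)).1 =
        (normalizedFactors a.1).map Q₁ + (normalizedFactors b.1).map Q₂ := by
      refine normalizedFactors_prod_of_prime fun q hq ↦ ?_
      rcases Multiset.mem_add.mp hq with hq | hq
      exacts [hpr₁ _ _ hq, hpr₂ _ _ hq]
    have heq := hfac a b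
    rw [hab, hfac a' b'] at heq
    have hf₁ (a : ι) : ((normalizedFactors a.1).map Q₁).filter
        (fun q ↦ q = Q₁ (q.under (𝓞 K))) = (normalizedFactors a.1).map Q₁ := by
      rw [Multiset.filter_eq_self]
      intro q hq
      obtain ⟨p, hp, rfl⟩ := Multiset.mem_map.mp hq
      obtain ⟨h1, h2, h3⟩ := hgood a p hp
      rw [(hQ₁ p h1 h2 h3).2.1]
    have hf₂ (a : ι) : ((normalizedFactors a.1).map Q₂).filter
        (fun q ↦ q = Q₁ (q.under (𝓞 K))) = 0 := by
      rw [Multiset.filter_eq_nil]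
      intro q hq
      obtain ⟨p, hp, rfl⟩ := Multiset.mem_map.mp hq
      obtain ⟨h1, h2, h3⟩ := hgood a p hp
      rw [(hQ₂ p h1 h2 h3).2.1]
      exact (hne p h1 h2 h3).symm
    have hu₁ (a : ι) : ((normalizedFactors a.1).map Q₁).map (fun q ↦ q.under (𝓞 K)) =
        normalizedFactors a.1 := by
      rw [Multiset.map_map]
      refine (Multiset.map_congr rfl fun p hp ↦ ?_).trans (Multiset.map_id _)
      obtain ⟨h1, h2, h3⟩ := hgood a p hp
      exact (hQ₁ p h1 h2 h3).2.1
    have hu₂ (a : ι) : ((normalizedFactors a.1).map Q₂).map (fun q ↦ q.under (𝓞 K)) =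
        normalizedFactors a.1 := by
      rw [Multiset.map_map]
      refine (Multiset.map_congr rfl fun p hp ↦ ?_).trans (Multiset.map_id _)
      obtain ⟨h1, h2, h3⟩ := hgood a p hp
      exact (hQ₂ p h1 h2 h3).2.1
    have hm₁ : (normalizedFactors a'.1).map Q₁ = (normalizedFactors a.1).map Q₁ := by
      have := congrArg (Multiset.filter (fun q ↦ q = Q₁ (q.under (𝓞 K)))) heq
      simpa only [Multiset.filter_add, hf₁, hf₂, add_zero] using this
    have hm₂ : (normalizedFactors b'.1).map Q₂ = (normalizedFactors b.1).map Q₂ := by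
      rw [hm₁] at heq
      exact add_left_cancel heq
    have ha := congrArg (Multiset.map (fun q ↦ q.under (𝓞 K))) hm₁
    have hb := congrArg (Multiset.map (fun q ↦ q.under (𝓞 K))) hm₂
    rw [hu₁, hu₁] at ha
    rw [hu₂, hu₂] at hb
    refine Prod.ext (Subtype.ext ?_) (Subtype.ext ?_)
    · change a.1 = a'.1
      rw [← Ideal.prod_normalizedFactors_eq_self a.2.1, ← ha,
        Ideal.prod_normalizedFactors_eq_self a'.2.1]
    · change b.1 = b'.1
      rw [← Ideal.prod_normalizedFactors_eq_self b.2.1, ← hb,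
        Ideal.prod_normalizedFactors_eq_self b'.2.1]

open scoped Pointwise

theorem absNorm_under_eq_of_stabilizer_eq_bot (K L : Type*) [Field K] [NumberField K] [Field L]
    [NumberField L] [Algebra K L] [IsGalois K L] (Q : Ideal (𝓞 L)) [Q.IsPrime] (hQ : Q ≠ ⊥)
    (h : MulAction.stabilizer Gal(L/K) Q = ⊥) :
    Ideal.absNorm Q = Ideal.absNorm (Q.under (𝓞 K)) := by
  set p := Q.under (𝓞 K) with hp
  have : Q.LiesOver p := ⟨rfl⟩
  have hp0 : p ≠ ⊥ := Ideal.IsIntegral.comap_ne_bot (𝓞 K) hQ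
  have : p.IsPrime := inferInstanceAs (Q.under (𝓞 K)).IsPrime
  have : p.IsMaximal := Ideal.IsPrime.isMaximal ‹_› hp0
  have : Finite (𝓞 K ⧸ p) := Ideal.finiteQuotientOfFreeOfNeBot p hp0
  have : Finite p.ResidueField :=
    Finite.of_surjective _ (Ideal.bijective_algebraMap_quotient_residueField p).2
  have hc := Ideal.card_stabilizer_eq_card_inertia_mul_finrank (G := Gal(L/K)) p Q
  rw [h, Subgroup.card_bot] at hc
  have hf : Q.inertiaDeg (𝓞 K) = 1 := Nat.eq_one_of_mul_eq_one_left hc.symm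
  have hQm : Q.IsMaximal := Ideal.IsPrime.isMaximal ‹_› hQ
  rw [Ideal.inertiaDeg_eq_of_isMaximal p] at hf
  let := Ideal.Quotient.field p
  have := Module.natCard_eq_pow_finrank (K := 𝓞 K ⧸ p) (V := 𝓞 L ⧸ Q)
  rw [hf, pow_one] at this
  simpa [Ideal.absNorm_apply, Submodule.cardQuot_apply] using this

theorem IsPrimitiveRoot.exists_pow_mul_of_pow_sub_pow_mem {R : Type*} [CommRing R] [IsDomain R]
    {ζ : R} {m : ℕ} [NeZero m] (hζ : IsPrimitiveRoot ζ m) (Q : Ideal R) [Q.IsPrime] {a b : R}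
    (h : a ^ m - b ^ m ∈ Q) : ∃ i < m, a - ζ ^ i * b ∈ Q := by
  rw [hζ.pow_sub_pow_eq_prod_sub_mul a b (NeZero.pos m)] at h
  obtain ⟨η, hη, hmem⟩ := Ideal.IsPrime.prod_mem_iff.1 h
  obtain ⟨i, hi, rfl⟩ := hζ.eq_pow_of_pow_eq_one ((Polynomial.mem_nthRootsFinset (NeZero.pos m) 1).1 hη)
  exact ⟨i, hi, hmem⟩

theorem smul_eq_of_mem_stabilizer (K L : Type*) [Field K] [NumberField K] [Field L]
    [NumberField L] [Algebra K L] [IsGalois K L] {m : ℕ} [NeZero m] {ζ : 𝓞 K}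
    (hζ : IsPrimitiveRoot ζ m) {x y : 𝓞 K} {θ : 𝓞 L} (hθ : θ ^ m = algebraMap (𝓞 K) (𝓞 L) x)
    (Q : Ideal (𝓞 L)) [Q.IsPrime] (hx : x ∉ Q.under (𝓞 K))
    (hd : ∀ i < m, i ≠ 0 → ζ ^ i - 1 ∉ Q.under (𝓞 K)) (hy : x - y ^ m ∈ Q.under (𝓞 K))
    {σ : Gal(L/K)} (hσ : σ ∈ MulAction.stabilizer Gal(L/K) Q) : σ • θ = θ := by
  set f := algebraMap (𝓞 K) (𝓞 L) with hf
  have hinj : Function.Injective f := FaithfulSMul.algebraMap_injective (𝓞 K) (𝓞 L)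
  have hζ' : IsPrimitiveRoot (f ζ) m := hζ.map_of_injective hinj
  have hfix : ∀ c, σ • f c = f c := fun c => smul_algebraMap σ c
  rw [Ideal.mem_comap, map_sub, map_pow, ← hf, ← hθ] at hy
  obtain ⟨i, -, hi⟩ := hζ'.exists_pow_mul_of_pow_sub_pow_mem Q hy
  obtain ⟨j, hjm, hj⟩ := hζ'.exists_pow_mul_of_pow_sub_pow_mem (⊥ : Ideal (𝓞 L))
    (a := σ • θ) (b := θ) (by rw [← smul_pow', hθ, hfix, sub_self]; exact zero_mem _)
  rw [Ideal.mem_bot, sub_eq_zero] at hj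
  by_cases hj0 : j = 0
  · simpa [hj0] using hj
  have hi' : σ • θ - f ζ ^ i * f y ∈ Q := by
    have : σ • (θ - f ζ ^ i * f y) ∈ σ • Q := Ideal.smul_mem_pointwise_smul _ _ _ hi
    rwa [MulAction.mem_stabilizer_iff.1 hσ, smul_sub, ← map_pow, ← map_mul, hfix, map_mul,
      map_pow] at this
  have hs := Q.sub_mem hi' hi
  rw [sub_sub_sub_cancel_right, hj, ← sub_one_mul] at hs
  rcases Ideal.IsPrime.mem_or_mem ‹_› hs with h1 | h1
  · exact absurd (by simpa [Ideal.mem_comap] using h1) (hd j hjm hj0)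
  · refine absurd ?_ hx
    rw [Ideal.mem_comap, ← hf, ← hθ]
    exact Ideal.pow_mem_of_mem _ h1 _ (NeZero.pos m)

open Polynomial in
theorem exists_pow_eq_of_forall_exists_pow_sub_mem (K : Type*) [Field K] [NumberField K] {m : ℕ}
    [NeZero m] {ζ : K} (hζ : IsPrimitiveRoot ζ m) (x D : 𝓞 K) (hD : D ≠ 0)
    (h : ∀ p : Ideal (𝓞 K), p.IsPrime → p ≠ ⊥ → D ∉ p → ∃ y : 𝓞 K, x - y ^ m ∈ p) :
    ∃ z : K, z ^ m = x := by
  have hm : m ≠ 0 := NeZero.ne m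
  by_contra! hne
  have hx0 : x ≠ 0 := fun hx => hne 0 (by simp [hx, hm])
  obtain ⟨ξ, hξ⟩ : ∃ ξ : 𝓞 K, (ξ : K) = ζ := ⟨⟨ζ, hζ.isIntegral (NeZero.pos m)⟩, rfl⟩
  have hprim : IsPrimitiveRoot ξ m :=
    IsPrimitiveRoot.of_map_of_injective (f := algebraMap (𝓞 K) K) (by subst hξ; exact hζ)
      RingOfIntegers.coe_injective
  let F : K[X] := X ^ m - C (x : K)
  let L := F.SplittingField
  have : CharZero L := charZero_of_injective_algebraMap (algebraMap K L).injective
  have : NumberField L := NumberField.of_module_finite K L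
  have : Normal K L := Normal.of_isSplittingField F
  have : IsGalois K L := ⟨⟩
  have hF0 : F ≠ 0 := X_pow_sub_C_ne_zero (NeZero.pos m) _
  have hroot : ∀ t : L, t ∈ F.rootSet L ↔ t ^ m = algebraMap K L x := by
    intro t
    rw [mem_rootSet_of_ne hF0]
    simp [F, sub_eq_zero]
  obtain ⟨t, ht⟩ : ∃ t : L, t ^ m = algebraMap K L x := by
    obtain ⟨t, ht⟩ := (IsSplittingField.splits L F).exists_eval_eq_zero (by
      rw [degree_map, degree_X_pow_sub_C (NeZero.pos m)]; exact_mod_cast hm)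
    exact ⟨t, by simpa [F, sub_eq_zero] using ht⟩
  obtain ⟨θ, hθt⟩ : ∃ θ : 𝓞 L, (θ : L) = t := by
    refine ⟨⟨t, IsIntegral.of_pow (NeZero.pos m) ?_⟩, rfl⟩
    rw [ht]
    exact (RingOfIntegers.isIntegral_coe x).algebraMap
  have hθ : θ ^ m = algebraMap (𝓞 K) (𝓞 L) x := by
    apply RingOfIntegers.coe_injective
    rw [map_pow]
    exact (congrArg (· ^ m) hθt).trans ht
  have hζL : IsPrimitiveRoot (algebraMap K L ζ) m := hζ.map_of_injective (algebraMap K L).injective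
  have htriv : ∀ σ : Gal(L/K), σ • θ = θ → σ = 1 := by
    intro σ hσ
    have hσt : σ t = t := by
      rw [← hθt]; exact congrArg (fun a : 𝓞 L => (a : L)) hσ
    have key : (σ : L →ₐ[K] L) = AlgHom.id K L := by
      refine AlgHom.ext_of_adjoin_eq_top (IsSplittingField.adjoin_rootSet L F) fun s hs => ?_
      rw [hroot] at hs
      obtain ⟨i, -, hi⟩ := hζL.exists_pow_mul_of_pow_sub_pow_mem (⊥ : Ideal L) (a := s) (b := t)
        (by rw [hs, ht, sub_self]; exact zero_mem _)
      rw [Ideal.mem_bot, sub_eq_zero] at hi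
      rw [hi]
      simp [hσt]
    ext a
    exact DFunLike.congr_fun key a
  obtain ⟨σ₀, hσ₀⟩ : ∃ σ : Gal(L/K), σ t ≠ t := by
    by_contra! hall
    obtain ⟨z, hz⟩ := (IsGalois.mem_range_algebraMap_iff_fixed t).2 hall
    refine hne z ((algebraMap K L).injective ?_)
    rw [map_pow, hz, ht]
  have hσ₀1 : σ₀ ≠ 1 := by
    rintro rfl
    exact hσ₀ rfl
  let E : 𝓞 K := ∏ i ∈ (Finset.range m).erase 0, (ξ ^ i - 1)
  have hE : E ≠ 0 := Finset.prod_ne_zero_iff.2 fun i hi => by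
    rw [Finset.mem_erase, Finset.mem_range] at hi
    exact sub_ne_zero.2 (hprim.pow_ne_one_of_pos_of_lt hi.1 hi.2)
  refine not_forall_exists_pair_primes_over K L (D * x * E) (mul_ne_zero (mul_ne_zero hD hx0) hE) ?_
  intro p hp hp0 hDp
  have hD' : D ∉ p := fun hc => hDp (p.mul_mem_right _ (p.mul_mem_right _ hc))
  have hx' : x ∉ p := fun hc => hDp (p.mul_mem_right _ (p.mul_mem_left _ hc))
  have hE' : ∀ i < m, i ≠ 0 → ξ ^ i - 1 ∉ p := fun i hi hi0 hc => hDp <| p.mul_mem_left _ <|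
    Ideal.mem_of_dvd _ (Finset.dvd_prod_of_mem _
      (Finset.mem_erase.2 ⟨hi0, Finset.mem_range.2 hi⟩)) hc
  obtain ⟨y, hy⟩ := h p hp hp0 hD'
  have hstab : ∀ Q : Ideal (𝓞 L), Q.IsPrime → Q.under (𝓞 K) = p →
      MulAction.stabilizer Gal(L/K) Q = ⊥ := by
    intro Q hQ hQp
    rw [eq_bot_iff]
    intro σ hσ
    exact htriv σ (smul_eq_of_mem_stabilizer K L hprim hθ Q (hQp ▸ hx') (hQp ▸ hE') (hQp ▸ hy) hσ)
  have hnorm : ∀ Q : Ideal (𝓞 L), Q.IsPrime → Q.under (𝓞 K) = p →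
      Ideal.absNorm Q = Ideal.absNorm p := by
    intro Q hQ hQp
    rw [absNorm_under_eq_of_stabilizer_eq_bot K L Q ?_ (hstab Q hQ hQp), hQp]
    rintro rfl
    exact hp0 (by rw [← hQp]; exact Ideal.under_bot _ _)
  obtain ⟨⟨Q, hQ, hQo⟩⟩ := Ideal.nonempty_primesOver (S := 𝓞 L) p
  have hQp : Q.under (𝓞 K) = p := hQo.over.symm
  have hQ₂ : (σ₀ • Q).IsPrime := inferInstance
  have hQ₂o : (σ₀ • Q).LiesOver p := inferInstance
  refine ⟨Q, σ₀ • Q, fun he => hσ₀1 ?_, ⟨hQ, hQp, hnorm Q hQ hQp⟩, hQ₂, hQ₂o.over.symm,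
    hnorm _ hQ₂ hQ₂o.over.symm⟩
  have : σ₀ ∈ MulAction.stabilizer Gal(L/K) Q := MulAction.mem_stabilizer_iff.2 he.symm
  rwa [hstab Q hQ hQp] at this

theorem exists_pow_eq_pow_of_zpow_eq_pow {F : Type*} [Field F] {ℓ w j : ℕ} (hℓ : ℓ.Prime)
    {x z : F} (hx : x ≠ 0) {e : ℤ} (he : ¬ ((ℓ : ℤ) ^ (w + 1) ∣ e)) (h : x ^ e = z ^ ℓ ^ j) :
    ∃ y : F, y ^ ℓ ^ j = x ^ ℓ ^ w := by
  obtain ⟨i, -, hi⟩ := (Nat.dvd_prime_pow hℓ).1 (Int.gcd_dvd_natAbs_right e ((ℓ ^ j : ℕ) : ℤ))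
  have hiw : i ≤ w := by
    by_contra! hlt
    refine he ((pow_dvd_pow (ℓ : ℤ) hlt).trans ?_)
    have := Int.gcd_dvd_left e ((ℓ ^ j : ℕ) : ℤ)
    rw [hi] at this
    exact_mod_cast this
  have hbez := Int.gcd_eq_gcd_ab e ((ℓ ^ j : ℕ) : ℤ)
  rw [hi] at hbez
  set u := Int.gcdA e ((ℓ ^ j : ℕ) : ℤ)
  set v := Int.gcdB e ((ℓ ^ j : ℕ) : ℤ)
  refine ⟨(z ^ u * x ^ v) ^ ℓ ^ (w - i), ?_⟩
  have h1 : x ^ ℓ ^ i = (z ^ u * x ^ v) ^ ℓ ^ j := by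
    rw [← zpow_natCast x (ℓ ^ i), hbez, zpow_add₀ hx, zpow_mul, h, mul_comm (_ : ℤ) v, zpow_mul,
      zpow_natCast, mul_pow, ← zpow_natCast (z ^ u), ← zpow_mul, mul_comm u, zpow_mul,
      zpow_natCast]
  rw [pow_right_comm, ← h1, ← pow_mul, ← pow_add, Nat.add_sub_cancel' hiw]

theorem exists_pow_eq_pow_of_isCyclotomicExtension {k K : Type*} [Field k] [CharZero k] [Field K]
    [Algebra k K] {ℓ w j M : ℕ} [NeZero M] [IsCyclotomicExtension {M} k K] (hℓ : ℓ.Prime)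
    (hw : ∀ ζ : k, ¬ IsPrimitiveRoot ζ (ℓ ^ (w + 1))) (hjM : ℓ ^ j ∣ M) (hwM : ℓ ^ (w + 1) ∣ M)
    {x : k} (hx : x ≠ 0) {y : K} (hy : y ^ ℓ ^ j = algebraMap k K x) :
    ∃ y : k, y ^ ℓ ^ j = x ^ ℓ ^ w := by
  have : IsGalois k K := IsCyclotomicExtension.isGalois {M} k K
  have : FiniteDimensional k K := IsCyclotomicExtension.finiteDimensional {M} k K
  have hcomm := IsCyclotomicExtension.isMulCommutative {M} k K
  have hζ := IsCyclotomicExtension.zeta_spec M k K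
  set ζ := IsCyclotomicExtension.zeta M k K
  obtain ⟨b, hb⟩ := hwM
  have hζw : IsPrimitiveRoot (ζ ^ b) (ℓ ^ (w + 1)) :=
    hζ.pow (NeZero.pos M) (by rw [hb, mul_comm])
  have hx' : algebraMap k K x ≠ 0 := by simpa using hx
  have hy0 : y ≠ 0 := by
    rintro rfl
    rw [zero_pow (pow_ne_zero _ hℓ.ne_zero)] at hy
    exact hx' hy.symm
  have hζ0 : ζ ≠ 0 := hζ.ne_zero (NeZero.ne M)
  obtain ⟨τ, hτ⟩ : ∃ τ : Gal(K/k), τ (ζ ^ b) ≠ ζ ^ b := by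
    by_contra! hall
    obtain ⟨η, hη⟩ := (IsGalois.mem_range_algebraMap_iff_fixed _).2 hall
    rw [← hη] at hζw
    exact hw η (hζw.of_map_of_injective (algebraMap k K).injective)
  obtain ⟨t, -, ht⟩ := hζ.eq_pow_of_pow_eq_one (ξ := τ ζ)
    (by rw [← map_pow, hζ.pow_eq_one, map_one])
  have hte : ¬ ((ℓ : ℤ) ^ (w + 1) ∣ 1 - t) := by
    rintro ⟨c, hc⟩
    have h1 : (ζ ^ b) ^ (1 - t : ℤ) = 1 := by
      rw [hc, zpow_mul, ← Nat.cast_pow, zpow_natCast, hζw.pow_eq_one, one_zpow]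
    rw [zpow_sub₀ (pow_ne_zero _ hζ0), zpow_one, zpow_natCast, div_eq_one_iff_eq (by positivity)] at h1
    apply hτ
    rw [map_pow, ← ht, pow_right_comm, ← h1]
  have hfix : ∀ σ : Gal(K/k), σ (τ y / y ^ t) = τ y / y ^ t := by
    intro σ
    obtain ⟨μ, hμ, hμy⟩ : ∃ μ : K, μ ^ M = 1 ∧ σ y = μ * y := by
      refine ⟨σ y / y, ?_, by field_simp⟩
      refine orderOf_dvd_iff_pow_eq_one.1 ((orderOf_dvd_of_pow_eq_one ?_).trans hjM)
      rw [div_pow, ← map_pow, hy, AlgEquiv.commutes, div_self hx']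
    obtain ⟨a, -, rfl⟩ := hζ.eq_pow_of_pow_eq_one hμ
    have hστ : σ (τ y) = (ζ ^ a) ^ t * τ y := by
      have : σ (τ y) = τ (σ y) := DFunLike.congr_fun (hcomm.is_comm.comm σ τ) y
      rw [this, hμy, map_mul, map_pow, ← ht, pow_right_comm]
    rw [map_div₀, map_pow, hστ, hμy, mul_pow]
    field_simp
  obtain ⟨z, hz⟩ := (IsGalois.mem_range_algebraMap_iff_fixed _).2 hfix
  refine exists_pow_eq_pow_of_zpow_eq_pow hℓ hx hte (z := z) ?_
  apply (algebraMap k K).injective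
  rw [map_pow, hz, map_zpow₀, div_pow, ← map_pow, hy, AlgEquiv.commutes, pow_right_comm, hy,
    zpow_sub₀ hx', zpow_one, zpow_natCast]

theorem exists_pow_eq_pow_of_forall_exists_pow_sub_mem (k : Type*) [Field k] [NumberField k]
    {ℓ w : ℕ} (hℓ : ℓ.Prime) (hw : ∀ ζ : k, ¬ IsPrimitiveRoot ζ (ℓ ^ (w + 1))) (j : ℕ)
    (x D : 𝓞 k) (hx : x ≠ 0) (hD : D ≠ 0)
    (h : ∀ p : Ideal (𝓞 k), p.IsPrime → p ≠ ⊥ → D ∉ p → ∃ y : 𝓞 k, x - y ^ ℓ ^ j ∈ p) :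
    ∃ y : k, y ^ ℓ ^ j = (x : k) ^ ℓ ^ w := by
  have : NeZero ℓ := ⟨hℓ.ne_zero⟩
  obtain ⟨M, hM⟩ : ∃ M, M = ℓ ^ max j (w + 1) := ⟨_, rfl⟩
  have hjM : ℓ ^ j ∣ M := hM ▸ pow_dvd_pow _ (le_max_left _ _)
  have hwM : ℓ ^ (w + 1) ∣ M := hM ▸ pow_dvd_pow _ (le_max_right _ _)
  have : NeZero M := ⟨hM ▸ pow_ne_zero _ hℓ.ne_zero⟩
  let K := CyclotomicField M k
  have hζ := IsCyclotomicExtension.zeta_spec M k K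
  obtain ⟨b, hb⟩ := id hjM
  let f := algebraMap (𝓞 k) (𝓞 K)
  have hinj : Function.Injective f := FaithfulSMul.algebraMap_injective (𝓞 k) (𝓞 K)
  obtain ⟨y, hy⟩ := exists_pow_eq_of_forall_exists_pow_sub_mem K
    (hζ.pow (NeZero.pos M) (hb.trans (mul_comm _ _))) (f x) (f D)
    (fun hc => hD (hinj (hc.trans (map_zero f).symm))) (by
      intro p hp hp0 hDp
      obtain ⟨y, hy⟩ := h (p.under (𝓞 k)) inferInstance (Ideal.IsIntegral.comap_ne_bot (𝓞 k) hp0) hDp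
      exact ⟨f y, by simpa [Ideal.mem_comap, f] using hy⟩)
  have hx' : (x : k) ≠ 0 := fun hc => hx (RingOfIntegers.coe_injective (by simpa using hc))
  exact exists_pow_eq_pow_of_isCyclotomicExtension (K := K) hℓ hw hjM hwM hx' hy

theorem coprime_orderOf_pow_of_not_dvd {H : Type*} [Group H] [Finite H] {ℓ r : ℕ} (hℓ : ℓ.Prime)
    {g : H} (hg : ¬ ℓ ^ r ∣ orderOf g) : ℓ.Coprime (orderOf (g ^ ℓ ^ r)) := by
  rw [hℓ.coprime_iff_not_dvd, orderOf_pow]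
  intro hdvd
  obtain ⟨i, hir, hi⟩ := (Nat.dvd_prime_pow hℓ).1 (Nat.gcd_dvd_right (orderOf g) (ℓ ^ r))
  rw [hi] at hdvd
  have hio : ℓ ^ i ∣ orderOf g := hi ▸ Nat.gcd_dvd_left _ _
  have hi1 : ℓ ^ (i + 1) ∣ orderOf g := by
    obtain ⟨c, hc⟩ := hdvd
    rw [Nat.div_eq_iff_eq_mul_left (pow_pos hℓ.pos _) hio] at hc
    exact ⟨c, by rw [hc]; ring⟩
  rcases hir.lt_or_eq with hlt | rfl
  · have : ℓ ^ (i + 1) ∣ ℓ ^ i := hi ▸ Nat.dvd_gcd hi1 (pow_dvd_pow _ hlt)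
    rw [Nat.pow_dvd_pow_iff_le_right hℓ.one_lt] at this
    lia
  · exact hg hio

open Height in
theorem exists_eq_pow_of_mulHeight₁_le {k : Type*} [Field k] [NumberField k] {ℓ : ℕ} (hℓ : 1 < ℓ)
    (B : ℝ) (hB : 0 ≤ B) (X y : ℕ → k) (hy : ∀ j, y j ^ ℓ ^ j = X j)
    (hX : ∀ j, mulHeight₁ (X j) ≤ B ^ ℓ ^ j) : ∃ j d, 0 < d ∧ X (j + d) = X j ^ ℓ ^ d := by
  have hle : ∀ j, y j ∈ {x : k | mulHeight₁ x ≤ B} := fun j => by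
    have := hX j
    rw [← hy, mulHeight₁_pow] at this
    exact (pow_le_pow_iff_left₀ (mulHeight₁_nonneg _) hB (by positivity)).1 this
  have : Finite {x : k | mulHeight₁ x ≤ B} := NumberField.finite_setOfPred_mulHeight₁_le k B
  obtain ⟨i, j, hne, heq'⟩ :=
    Finite.exists_ne_map_eq_of_infinite (fun j : ℕ => (⟨y j, hle j⟩ : {x : k | mulHeight₁ x ≤ B}))
  have heq : y i = y j := congrArg Subtype.val heq'
  clear heq'
  wlog hij : i < j generalizing i j
  · exact this j i hne.symm heq.symm (by lia)
  refine ⟨i, j - i, by lia, ?_⟩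
  rw [← hy i, heq, ← pow_mul, ← pow_add, Nat.add_sub_cancel' hij.le, hy]

section LocalPowers

variable {k : Type*} [Field k] [NumberField k] {G : Type*} [CommGroup G] {ι : G →* k}
  {I : Type*} {H : I → Type*} [∀ i, CommGroup (H i)] [∀ i, Finite (H i)] {φ : ∀ i, G →* H i}

open Height in
theorem exists_pow_dvd_orderOf (hι : Function.Injective ι) {ℓ w : ℕ} (hℓ : ℓ.Prime)
    (hloc : ∀ (j : ℕ) (x : G), (∀ i, ∃ u, φ i x = u ^ ℓ ^ j) → ∃ y : k, y ^ ℓ ^ j = ι x ^ ℓ ^ w)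
    {ω : G} (hω : ¬ IsOfFinOrder ω) (r : ℕ) : ∃ i, ℓ ^ r ∣ orderOf (φ i ω) := by
  by_contra! hno
  have hpow : ∀ j i, ∃ u, φ i (ω ^ ℓ ^ r) = u ^ ℓ ^ j := fun j i => by
    obtain ⟨m, hm⟩ := exists_pow_eq_self_of_coprime
      ((coprime_orderOf_pow_of_not_dvd hℓ (hno i)).pow_left j)
    exact ⟨(φ i ω ^ ℓ ^ r) ^ m, by rw [map_pow, ← pow_mul, mul_comm, pow_mul, hm]⟩
  choose y hy using fun j => hloc j (ω ^ ℓ ^ r) (hpow j)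
  obtain ⟨j, d, hd, hX⟩ := exists_eq_pow_of_mulHeight₁_le hℓ.one_lt
    (mulHeight₁ (ι (ω ^ ℓ ^ r) ^ ℓ ^ w)) (mulHeight₁_nonneg _) _ y hy
    fun j => le_self_pow₀ (one_le_mulHeight₁ _) (pow_ne_zero _ hℓ.ne_zero)
  rw [← map_pow, ← map_pow, hι.eq_iff, ← pow_mul, ← pow_mul] at hX
  refine hω (isOfFinOrder_iff_pow_eq_one.2
    ⟨ℓ ^ r * ℓ ^ w * ℓ ^ d - ℓ ^ r * ℓ ^ w, Nat.sub_pos_of_lt ?_, ?_⟩)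
  · exact lt_mul_of_one_lt_right (mul_pos (pow_pos hℓ.pos _) (pow_pos hℓ.pos _))
      (Nat.one_lt_pow hd.ne' hℓ.one_lt)
  · rw [pow_sub _ (Nat.le_mul_of_pos_right _ (pow_pos hℓ.pos _)), ← hX, mul_inv_cancel]

open Height in
theorem exists_pow_mem_zpowers (hι : Function.Injective ι) {ℓ w : ℕ} (hℓ : ℓ.Prime)
    (hloc : ∀ (j : ℕ) (x : G), (∀ i, ∃ u, φ i x = u ^ ℓ ^ j) → ∃ y : k, y ^ ℓ ^ j = ι x ^ ℓ ^ w)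
    {x ω : G} (hω : ¬ IsOfFinOrder ω)
    (h : ∀ i j, ∃ n : ℤ, φ i x = φ i ω ^ n ∧ φ j x = φ j ω ^ n) :
    ∃ A, A ≠ 0 ∧ x ^ A ∈ Subgroup.zpowers ω := by
  have hex : ∀ j, ∃ n < ℓ ^ j, ∀ i, ∃ u, φ i (x * (ω ^ n)⁻¹) = u ^ ℓ ^ j := by
    intro j
    obtain ⟨q, hq⟩ := exists_pow_dvd_orderOf hι hℓ hloc hω j
    obtain ⟨n₀, hn₀, -⟩ := h q q
    have hpos : (0 : ℤ) < (ℓ ^ j : ℕ) := mod_cast pow_pos hℓ.pos _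
    refine ⟨(n₀ % (ℓ ^ j : ℕ)).toNat, ?_, fun i => ?_⟩
    · have := Int.emod_lt_of_pos n₀ hpos
      lia
    obtain ⟨n, hni, hnq⟩ := h i q
    have h1 : ((ℓ ^ j : ℕ) : ℤ) ∣ n - n₀ := by
      refine (Int.natCast_dvd_natCast.2 hq).trans (orderOf_dvd_iff_zpow_eq_one.2 ?_)
      rw [zpow_sub, ← hnq, ← hn₀, mul_inv_cancel]
    have h2 : ((ℓ ^ j : ℕ) : ℤ) ∣ n - (n₀ % (ℓ ^ j : ℕ)).toNat := by
      rw [Int.toNat_of_nonneg (Int.emod_nonneg _ hpos.ne')]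
      have := dvd_add h1 (Int.dvd_self_sub_emod (x := n₀) (m := (ℓ ^ j : ℕ)))
      rwa [sub_add_sub_cancel] at this
    obtain ⟨t, ht⟩ := h2
    refine ⟨φ i ω ^ t, ?_⟩
    rw [← zpow_natCast (φ i ω ^ t), ← zpow_mul, mul_comm t, ← ht, map_mul, map_inv, map_pow, hni, zpow_sub,
      zpow_natCast]
  choose n hn hpow using hex
  choose y hy using fun j => hloc j _ (hpow j)
  have hheight : ∀ j, mulHeight₁ (ι (x * (ω ^ n j)⁻¹) ^ ℓ ^ w) ≤
      ((mulHeight₁ (ι x) * mulHeight₁ (ι ω)) ^ ℓ ^ w) ^ ℓ ^ j := by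
    intro j
    have h1 : mulHeight₁ (ι (ω ^ n j)⁻¹) = mulHeight₁ (ι ω) ^ n j := by
      have : ι (ω ^ n j)⁻¹ = (ι ω ^ n j)⁻¹ := by
        rw [← map_pow]
        exact eq_inv_of_mul_eq_one_left (by rw [← map_mul, inv_mul_cancel, map_one])
      rw [this, mulHeight₁_inv, mulHeight₁_pow]
    have hx1 := one_le_mulHeight₁ (ι x)
    have hω1 := one_le_mulHeight₁ (ι ω)
    rw [mulHeight₁_pow, pow_right_comm]
    gcongr
    rw [map_mul, mul_pow]
    refine (mulHeight₁_mul_le _ _).trans ?_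
    rw [h1]
    gcongr
    · exact le_self_pow₀ hx1 (pow_ne_zero _ hℓ.ne_zero)
    · exact (hn j).le
  obtain ⟨j, d, hd, hX⟩ := exists_eq_pow_of_mulHeight₁_le hℓ.one_lt _ (by positivity) _ y hy hheight
  rw [← map_pow, ← map_pow, ← map_pow, hι.eq_iff] at hX
  have hmem : ∀ a : ℕ, QuotientGroup.mk' (Subgroup.zpowers ω) (ω ^ a) = 1 := fun a =>
    (QuotientGroup.eq_one_iff _).2 (Subgroup.npow_mem_zpowers ω a)
  have hX := congrArg (QuotientGroup.mk' (Subgroup.zpowers ω)) hX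
  simp only [map_pow, map_mul, map_inv] at hX hmem
  rw [hmem, hmem, inv_one, mul_one, ← pow_mul] at hX
  refine ⟨ℓ ^ w * ℓ ^ d - ℓ ^ w, (Nat.sub_pos_of_lt ?_).ne', (QuotientGroup.eq_one_iff _).1 ?_⟩
  · exact lt_mul_of_one_lt_right (pow_pos hℓ.pos _) (Nat.one_lt_pow hd.ne' hℓ.one_lt)
  · change QuotientGroup.mk' _ _ = _
    rw [map_pow, pow_sub _ (Nat.le_mul_of_pos_right _ (pow_pos hℓ.pos _)), ← hX, mul_inv_cancel]

theorem mem_zpowers_of_prime_pow_mem_zpowers (hφ : ∀ x : G, x ≠ 1 → ∃ i, φ i x ≠ 1) {ℓ : ℕ}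
    (hℓ : ℓ.Prime) {x ω : G} (hω : ∀ r, ∃ i, ℓ ^ r ∣ orderOf (φ i ω))
    (h : ∀ i j, ∃ n : ℤ, φ i x = φ i ω ^ n ∧ φ j x = φ j ω ^ n)
    (hx : x ^ ℓ ∈ Subgroup.zpowers ω) : x ∈ Subgroup.zpowers ω := by
  obtain ⟨B, hB⟩ := hx
  have hB : ω ^ B = x ^ ℓ := hB
  have hord : ∀ i (n : ℤ), φ i x = φ i ω ^ n → (orderOf (φ i ω) : ℤ) ∣ n * ℓ - B := by
    intro i n hn
    rw [orderOf_dvd_iff_zpow_eq_one, zpow_sub, zpow_mul, ← hn, zpow_natCast, ← map_zpow, hB,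
      map_pow, mul_inv_cancel]
  have hℓB : (ℓ : ℤ) ∣ B := by
    obtain ⟨q, hq⟩ := hω 1
    obtain ⟨n, hn, -⟩ := h q q
    have := (Int.natCast_dvd_natCast.2 hq).trans (hord q n hn)
    rw [pow_one] at this
    have h2 := dvd_sub (Dvd.intro_left n rfl) this
    rwa [sub_sub_cancel] at h2
  obtain ⟨b, rfl⟩ := hℓB
  suffices x * (ω ^ b)⁻¹ = 1 from ⟨b, (mul_inv_eq_one.1 this).symm⟩
  by_contra hne
  obtain ⟨p, hp⟩ := hφ _ hne
  apply hp
  obtain ⟨r, m, hm, hr⟩ := Nat.exists_eq_pow_mul_and_not_dvd (orderOf_pos (φ p ω)).ne' ℓ hℓ.ne_one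
  obtain ⟨q, hq⟩ := hω (r + 1)
  obtain ⟨n, hnp, hnq⟩ := h p q
  have h1 : (ℓ : ℤ) ^ r ∣ n - b := by
    have := (Int.natCast_dvd_natCast.2 hq).trans (hord q n hnq)
    rw [mul_comm n, ← mul_sub, Nat.cast_pow, pow_succ'] at this
    exact (mul_dvd_mul_iff_left (mod_cast hℓ.ne_zero)).1 this
  have heq : φ p (x * (ω ^ b)⁻¹) = φ p ω ^ (n - b) := by
    rw [map_mul, map_inv, map_zpow, hnp, zpow_sub]
  obtain ⟨t, ht⟩ := h1
  have hpm : φ p (x * (ω ^ b)⁻¹) ^ m = 1 := by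
    rw [heq, ht, ← zpow_natCast, ← zpow_mul, mul_right_comm, ← Nat.cast_pow, ← Nat.cast_mul, ← hr,
      zpow_mul, zpow_natCast, pow_orderOf_eq_one, one_zpow]
  have hpl : φ p (x * (ω ^ b)⁻¹) ^ ℓ = 1 := by
    rw [← map_pow, mul_pow, ← hB, inv_pow, ← zpow_natCast, ← zpow_mul, mul_comm b, mul_inv_cancel,
      map_one]
  have := Nat.dvd_gcd (orderOf_dvd_of_pow_eq_one hpl) (orderOf_dvd_of_pow_eq_one hpm)
  rwa [(hℓ.coprime_iff_not_dvd.2 hm).gcd_eq_one, Nat.dvd_one, orderOf_eq_one_iff] at this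

theorem mem_zpowers_of_forall_exists_zpow (hι : Function.Injective ι)
    (hφ : ∀ s : Finset G, 1 ∉ s → ∃ i, ∀ x ∈ s, φ i x ≠ 1)
    (hloc : ∀ ℓ : ℕ, ℓ.Prime → ∃ w, ∀ (j : ℕ) (x : G), (∀ i, ∃ u, φ i x = u ^ ℓ ^ j) →
      ∃ y : k, y ^ ℓ ^ j = ι x ^ ℓ ^ w)
    {x ω : G} (h : ∀ i j, ∃ n : ℤ, φ i x = φ i ω ^ n ∧ φ j x = φ j ω ^ n) :
    x ∈ Subgroup.zpowers ω := by
  by_cases hω : IsOfFinOrder ω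
  · have : Finite (Subgroup.zpowers ω) := hω.finite_zpowers
    classical
    by_contra hx
    obtain ⟨i, hi⟩ := hφ ((Subgroup.zpowers ω : Set G).toFinite.toFinset.image fun y => x * y⁻¹) (by
      simp only [Finset.mem_image, not_exists, not_and, Set.Finite.mem_toFinset, SetLike.mem_coe]
      intro y hy hc
      exact hx (mul_inv_eq_one.1 hc ▸ hy))
    obtain ⟨n, hn, -⟩ := h i i
    refine hi (x * (ω ^ n)⁻¹) (Finset.mem_image.2 ⟨ω ^ n, by simp, rfl⟩) ?_
    rw [map_mul, map_inv, map_zpow, hn, mul_inv_cancel]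
  have hφ' : ∀ x : G, x ≠ 1 → ∃ i, φ i x ≠ 1 := fun x hx => by
    simpa using hφ {x} (by simpa using hx.symm)
  obtain ⟨w, hw⟩ := hloc 2 Nat.prime_two
  obtain ⟨A, hA, hxA⟩ := exists_pow_mem_zpowers hι Nat.prime_two hw hω h
  induction A using induction_on_primes generalizing x with
  | zero => exact absurd rfl hA
  | one => simpa using hxA
  | prime_mul ℓ A hℓ ih =>
    refine ih h (right_ne_zero_of_mul hA) ?_
    obtain ⟨w, hw⟩ := hloc ℓ hℓ
    refine mem_zpowers_of_prime_pow_mem_zpowers hφ' hℓ (exists_pow_dvd_orderOf hι hℓ hw hω)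
      (fun i j => ?_) (by rwa [← pow_mul, mul_comm])
    obtain ⟨n, h1, h2⟩ := h i j
    refine ⟨n * A, ?_, ?_⟩ <;> rw [map_pow, zpow_mul, zpow_natCast] <;> simp [h1, h2]

end LocalPowers

section Localization

theorem exists_awayUnits_eq_div {R : Type*} [CommRing R] {D a b : R} (ha : a ∣ D) (hb : b ∣ D) :
    ∃ u : (Localization.Away D)ˣ,
      (u : Localization.Away D) * algebraMap _ _ b = algebraMap _ _ a := by
  obtain ⟨ua, hua⟩ := IsLocalization.Away.isUnit_of_dvd (S := Localization.Away D) D ha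
  obtain ⟨ub, hub⟩ := IsLocalization.Away.isUnit_of_dvd (S := Localization.Away D) D hb
  exact ⟨ua * ub⁻¹, by rw [← hua, ← hub]; simp⟩

variable {k : Type*} [Field k]

/-- The inclusion into `k` of the units of `𝓞 k` with the non-zero element `D` inverted. -/
noncomputable def awayUnitsToField {D : 𝓞 k} (hD : D ≠ 0) : (Localization.Away D)ˣ →* k :=
  (IsLocalization.Away.lift (S := Localization.Away D) D (g := algebraMap (𝓞 k) k)
    (isUnit_iff_ne_zero.2 (by simpa using hD))).toMonoidHom.comp (Units.coeHom _)

theorem awayUnitsToField_mul {D : 𝓞 k} (hD : D ≠ 0) (u : (Localization.Away D)ˣ) {a b : 𝓞 k}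
    (h : (u : Localization.Away D) * algebraMap _ _ b = algebraMap _ _ a) :
    awayUnitsToField hD u * algebraMap (𝓞 k) k b = algebraMap (𝓞 k) k a := by
  have := congrArg (IsLocalization.Away.lift D (g := algebraMap (𝓞 k) k)
    (isUnit_iff_ne_zero.2 (by simpa using hD))) h
  rwa [map_mul, IsLocalization.Away.lift_eq, IsLocalization.Away.lift_eq] at this

theorem awayUnitsToField_injective {D : 𝓞 k} (hD : D ≠ 0) :
    Function.Injective (awayUnitsToField hD) := by
  intro u v huv
  refine Units.ext ?_
  refine (IsLocalization.lift_injective_iff (M := Submonoid.powers D)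
    (S := Localization.Away D) _).2 (fun x y => ?_) huv
  rw [(IsLocalization.injective (Localization.Away D)
    (powers_le_nonZeroDivisors_of_noZeroDivisors hD)).eq_iff,
    (FaithfulSMul.algebraMap_injective (𝓞 k) k).eq_iff]

variable [NumberField k]

theorem exists_isPrime_not_mem {D : 𝓞 k} (hD : D ≠ 0) :
    ∃ p : Ideal (𝓞 k), p.IsPrime ∧ p ≠ ⊥ ∧ D ∉ p := by
  by_contra! h
  exact not_forall_exists_pair_primes_over k k D hD fun p hp hp0 hDp => absurd (h p hp hp0) hDp

theorem exists_forall_not_isPrimitiveRoot_prime_pow (k : Type*) [Field k] [NumberField k] {ℓ : ℕ}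
    (hℓ : ℓ.Prime) : ∃ w, ∀ ζ : k, ¬ IsPrimitiveRoot ζ (ℓ ^ (w + 1)) := by
  refine ⟨NumberField.Units.torsionOrder k, fun ζ hζ => ?_⟩
  have : NeZero ℓ := ⟨hℓ.ne_zero⟩
  have h1 := Nat.le_of_dvd (NumberField.Units.torsionOrder_pos k)
    (NumberField.Units.dvd_torsionOrder_of_isPrimitiveRoot hζ)
  have h2 := Nat.lt_pow_self (n := NumberField.Units.torsionOrder k + 1) hℓ.one_lt
  lia

theorem isUnit_quotientMk {D : 𝓞 k} (p : {p : Ideal (𝓞 k) // p.IsPrime ∧ p ≠ ⊥ ∧ D ∉ p}) :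
    IsUnit (Ideal.Quotient.mk p.1 D) := by
  have : p.1.IsMaximal := p.2.1.isMaximal p.2.2.1
  let := Ideal.Quotient.field p.1
  exact isUnit_iff_ne_zero.2 (mt Ideal.Quotient.eq_zero_iff_mem.1 p.2.2.2)

/-- Reduction modulo `p` of the units of `𝓞 k` with `D ∉ p` inverted. -/
noncomputable def awayUnitsToQuotient (D : 𝓞 k)
    (p : {p : Ideal (𝓞 k) // p.IsPrime ∧ p ≠ ⊥ ∧ D ∉ p}) :
    (Localization.Away D)ˣ →* (𝓞 k ⧸ p.1)ˣ :=
  Units.map (IsLocalization.Away.lift (S := Localization.Away D) D (g := Ideal.Quotient.mk p.1)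
    (isUnit_quotientMk p)).toMonoidHom

theorem awayUnitsToQuotient_mul (D : 𝓞 k)
    (p : {p : Ideal (𝓞 k) // p.IsPrime ∧ p ≠ ⊥ ∧ D ∉ p}) (u : (Localization.Away D)ˣ) {a b : 𝓞 k}
    (h : (u : Localization.Away D) * algebraMap _ _ b = algebraMap _ _ a) :
    (awayUnitsToQuotient D p u : 𝓞 k ⧸ p.1) * Ideal.Quotient.mk p.1 b =
      Ideal.Quotient.mk p.1 a := by
  have := congrArg (IsLocalization.Away.lift D (g := Ideal.Quotient.mk p.1)
    (isUnit_quotientMk p)) h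
  rwa [map_mul, IsLocalization.Away.lift_eq, IsLocalization.Away.lift_eq] at this

theorem exists_forall_awayUnitsToQuotient_ne_one {D : 𝓞 k} (hD : D ≠ 0)
    (s : Finset (Localization.Away D)ˣ) (hs : 1 ∉ s) :
    ∃ p, ∀ u ∈ s, awayUnitsToQuotient D p u ≠ 1 := by
  choose N a ha using fun u : (Localization.Away D)ˣ =>
    IsLocalization.Away.surj D (u : Localization.Away D)
  have hne : D * ∏ u ∈ s, (a u - D ^ N u) ≠ 0 := by
    refine mul_ne_zero hD (Finset.prod_ne_zero_iff.2 fun u hu hc => hs ?_)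
    have h1 := ha u
    rw [sub_eq_zero.1 hc, map_pow] at h1
    have h2 : (u : Localization.Away D) = 1 :=
      (IsLocalization.Away.algebraMap_pow_isUnit D (N u)).mul_eq_right.1 h1
    rwa [← Units.val_eq_one.1 h2]
  obtain ⟨p, hp, hp0, hDp⟩ := exists_isPrime_not_mem hne
  refine ⟨⟨p, hp, hp0, fun hc => hDp (p.mul_mem_right _ hc)⟩, fun u hu hc => hDp ?_⟩
  refine p.mul_mem_left _ (Ideal.mem_of_dvd _ (Finset.dvd_prod_of_mem _ hu) ?_)
  have := awayUnitsToQuotient_mul D ⟨p, hp, hp0, fun hc => hDp (p.mul_mem_right _ hc)⟩ u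
    (a := a u) (b := D ^ N u) (by rw [map_pow]; exact ha u)
  rw [hc, Units.val_one, one_mul] at this
  exact Ideal.Quotient.eq.1 this.symm

theorem exists_pow_eq_awayUnitsToField_pow {D : 𝓞 k} (hD : D ≠ 0) {ℓ w : ℕ} (hℓ : ℓ.Prime)
    (hw : ∀ ζ : k, ¬ IsPrimitiveRoot ζ (ℓ ^ (w + 1))) (j : ℕ) (x : (Localization.Away D)ˣ)
    (h : ∀ p, ∃ u, awayUnitsToQuotient D p x = u ^ ℓ ^ j) :
    ∃ y : k, y ^ ℓ ^ j = awayUnitsToField hD x ^ ℓ ^ w := by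
  have hinj := IsLocalization.injective (Localization.Away D)
    (powers_le_nonZeroDivisors_of_noZeroDivisors hD)
  obtain ⟨N, a, ha⟩ := IsLocalization.Away.surj D (x : Localization.Away D)
  rw [← map_pow] at ha
  obtain ⟨m, hm⟩ : ∃ m, ℓ ^ j = m + 1 := Nat.exists_eq_succ_of_ne_zero (pow_ne_zero _ hℓ.ne_zero)
  have hx : (x : Localization.Away D) * algebraMap _ _ ((D ^ N) ^ ℓ ^ j) =
      algebraMap _ _ (a * (D ^ N) ^ m) := by
    rw [hm, pow_succ', map_mul, ← mul_assoc, ha, map_mul]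
  have ha0 : a ≠ 0 := by
    rintro rfl
    rw [map_zero, Units.mul_right_eq_zero] at ha
    exact pow_ne_zero N hD (hinj (ha.trans (map_zero _).symm))
  obtain ⟨y, hy⟩ := exists_pow_eq_pow_of_forall_exists_pow_sub_mem k hℓ hw j (a * (D ^ N) ^ m) D
    (mul_ne_zero ha0 (pow_ne_zero _ (pow_ne_zero _ hD))) hD (by
      intro p hp hp0 hDp
      obtain ⟨u, hu⟩ := h ⟨p, hp, hp0, hDp⟩
      obtain ⟨v, hv⟩ := Ideal.Quotient.mk_surjective (u : 𝓞 k ⧸ p)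
      refine ⟨v * D ^ N, ?_⟩
      rw [← Ideal.Quotient.eq, ← awayUnitsToQuotient_mul D ⟨p, hp, hp0, hDp⟩ x hx, hu,
        Units.val_pow_eq_pow_val, ← hv, ← map_pow, ← map_mul, mul_pow])
  refine ⟨y / algebraMap (𝓞 k) k (D ^ N) ^ ℓ ^ w, ?_⟩
  have hxk := awayUnitsToField_mul hD x hx
  rw [div_pow, hy, pow_right_comm (algebraMap (𝓞 k) k (D ^ N)), ← div_pow, ← map_pow]
  congr 1
  rw [div_eq_iff (by simp [hD])]
  exact hxk.symm

end Localization

/-- Let `k` be a number field and `λ`, `ω` non-zero elements of `k` such that `λ` is not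
an integer power of `ω`.  Let `P` be a finite set of non-zero prime ideals of `𝓞 k`.
Then there are non-zero primes `𝔭`, `𝔮` outside `P` such that `λ` and `ω` have
non-negative valuation at both, and the pair `(η_𝔭 λ, η_𝔮 λ)` is not a multiplicative
power of `(η_𝔭 ω, η_𝔮 ω)` in the product of the residue fields: for every integer `n`
(non-negative powers being `λ = ω ^ n` and negative powers being `λ * ω ^ n = 1`),
the pair equality fails. -/
theorem pair_of_residue_maps_detecting_powers
    (k : Type) [Field k] [NumberField k]
    (lam ω : k) (hlam : lam ≠ 0) (hω : ω ≠ 0)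
    (h : ∀ n : ℤ, lam ≠ ω ^ n)
    (P : Finset (Ideal (𝓞 k))) (hP : ∀ 𝔭 ∈ P, 𝔭.IsPrime ∧ 𝔭 ≠ ⊥) :
    ∃ 𝔭 𝔮 : Ideal (𝓞 k),
      𝔭.IsPrime ∧ 𝔭 ≠ ⊥ ∧ 𝔭 ∉ P ∧ 𝔮.IsPrime ∧ 𝔮 ≠ ⊥ ∧ 𝔮 ∉ P ∧
      ∃ (cl₁ cω₁ : (𝓞 k) ⧸ 𝔭) (cl₂ cω₂ : (𝓞 k) ⧸ 𝔮),
        ResidueImage 𝔭 lam cl₁ ∧ ResidueImage 𝔭 ω cω₁ ∧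
        ResidueImage 𝔮 lam cl₂ ∧ ResidueImage 𝔮 ω cω₂ ∧
        (∀ n : ℕ, ¬(cl₁ = cω₁ ^ n ∧ cl₂ = cω₂ ^ n)) ∧
        (∀ n : ℕ, ¬(cl₁ * cω₁ ^ n = 1 ∧ cl₂ * cω₂ ^ n = 1)) := by
  obtain ⟨a, b, hb, rfl⟩ := IsFractionRing.div_surjective (A := 𝓞 k) lam
  obtain ⟨c, d, hd, rfl⟩ := IsFractionRing.div_surjective (A := 𝓞 k) ω
  rw [div_ne_zero_iff] at hlam hω
  have hbk := hlam.2
  have hdk := hω.2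
  simp only [ne_eq, FaithfulSMul.algebraMap_eq_zero_iff] at hlam hω
  choose! e he he0 using fun 𝔭 (h𝔭 : 𝔭 ∈ P) => Submodule.exists_mem_ne_zero_of_ne_bot (hP 𝔭 h𝔭).2
  obtain ⟨D, hDdef⟩ : ∃ D, D = a * b * (c * d) * ∏ 𝔭 ∈ P, e 𝔭 := ⟨_, rfl⟩
  have hD : D ≠ 0 := hDdef ▸ mul_ne_zero (mul_ne_zero (mul_ne_zero hlam.1 hlam.2)
    (mul_ne_zero hω.1 hω.2)) (Finset.prod_ne_zero_iff.2 he0)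
  have haD : a ∣ D := ⟨b * (c * d) * ∏ 𝔭 ∈ P, e 𝔭, by rw [hDdef]; ring⟩
  have hbD : b ∣ D := ⟨a * (c * d) * ∏ 𝔭 ∈ P, e 𝔭, by rw [hDdef]; ring⟩
  have hcD : c ∣ D := ⟨a * b * d * ∏ 𝔭 ∈ P, e 𝔭, by rw [hDdef]; ring⟩
  have hdD : d ∣ D := ⟨a * b * c * ∏ 𝔭 ∈ P, e 𝔭, by rw [hDdef]; ring⟩
  have hDP : ∀ p : Ideal (𝓞 k), D ∉ p → p ∉ P := fun p hDp hp => hDp <|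
    Ideal.mem_of_dvd _ ((Finset.dvd_prod_of_mem e hp).trans ⟨_, hDdef.trans (mul_comm _ _)⟩)
      (he p hp)
  obtain ⟨u, hu⟩ := exists_awayUnits_eq_div haD hbD
  obtain ⟨v, hv⟩ := exists_awayUnits_eq_div hcD hdD
  have himage : ∀ (p : {p : Ideal (𝓞 k) // p.IsPrime ∧ p ≠ ⊥ ∧ D ∉ p}) (x : (Localization.Away D)ˣ)
      (s t : 𝓞 k), t ∣ D → algebraMap (𝓞 k) k t ≠ 0 →
      (x : Localization.Away D) * algebraMap _ _ t = algebraMap _ _ s →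
      ResidueImage p.1 (algebraMap (𝓞 k) k s / algebraMap (𝓞 k) k t)
        (awayUnitsToQuotient D p x) := fun p x s t ht ht0 hx =>
    ⟨s, t, fun hc => p.2.2.2 (Ideal.mem_of_dvd _ ht hc), div_mul_cancel₀ _ ht0,
      (awayUnitsToQuotient_mul D p x hx).symm⟩
  by_contra hcon
  have hfin : ∀ p : {p : Ideal (𝓞 k) // p.IsPrime ∧ p ≠ ⊥ ∧ D ∉ p}, Finite (𝓞 k ⧸ p.1)ˣ := by
    intro p
    have := Ideal.finiteQuotientOfFreeOfNeBot p.1 p.2.2.1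
    infer_instance
  have hmem : u ∈ Subgroup.zpowers v := by
    refine mem_zpowers_of_forall_exists_zpow (ι := awayUnitsToField hD)
      (φ := awayUnitsToQuotient D) (awayUnitsToField_injective hD)
      (exists_forall_awayUnitsToQuotient_ne_one hD) (fun ℓ hℓ => ?_) (fun p q => ?_)
    · obtain ⟨w, hw⟩ := exists_forall_not_isPrimitiveRoot_prime_pow k hℓ
      exact ⟨w, exists_pow_eq_awayUnitsToField_pow hD hℓ hw⟩
    by_contra! hpq
    refine hcon ⟨p.1, q.1, p.2.1, p.2.2.1, hDP _ p.2.2.2, q.2.1, q.2.2.1, hDP _ q.2.2.2,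
      awayUnitsToQuotient D p u, awayUnitsToQuotient D p v, awayUnitsToQuotient D q u,
      awayUnitsToQuotient D q v, himage p u a b hbD hbk hu, himage p v c d hdD hdk hv,
      himage q u a b hbD hbk hu, himage q v c d hdD hdk hv, ?_, ?_⟩
    · rintro n ⟨h1, h2⟩
      refine hpq n ?_ ?_ <;> rw [zpow_natCast] <;> exact Units.ext (by simpa)
    · rintro n ⟨h1, h2⟩
      refine hpq (-n) ?_ ?_ <;> rw [zpow_neg, zpow_natCast, eq_inv_iff_mul_eq_one] <;>
        exact Units.ext (by simpa)
  obtain ⟨n, hn⟩ := hmem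
  refine h n ?_
  rw [← eq_div_of_mul_eq hbk (awayUnitsToField_mul hD u hu),
    ← eq_div_of_mul_eq hdk (awayUnitsToField_mul hD v hv), ← hn]
  exact (congrArg Units.val (map_zpow (awayUnitsToField hD).toHomUnits v n)).trans
    (Units.val_zpow_eq_zpow_val _ _)
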